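/- arXiv:2105.05615 — 2 statements merged into one kernel-verified Lean document; each statement's English description precedes it below -/
import Mathlib

section
/- Let Σ denote the surface (volume) measure on the unit sphere S⁸ of ℝ⁹, and let λ denote Lebesgue measure on ℝ⁹. For every z ∈ ℝ⁹ with z ≠ 0 and every ε > 0, writing x = ‖z‖, one has ∫_{{w ∈ ℝ⁹ : ‖w‖ ≤ ε}} ‖w‖^{−4} · ‖w − z‖^{−7} λ(dw) = Σ(S⁸) · ∫_0^ε ρ⁴ · (max(x, ρ))^{−7} dρ. -/
open MeasureTheory

/-- The surface (volume) measure `Σ` on the unit sphere `S⁸` of `ℝ⁹`. -/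
noncomputable def sphereMeasure :
    Measure (Metric.sphere (0 : EuclideanSpace ℝ (Fin 9)) 1) :=
  (volume : Measure (EuclideanSpace ℝ (Fin 9))).toSphere

open Set Real in
/-- Integration of a radial function in polar coordinates. -/
theorem lintegral_norm_eq_toSphere_mul {E : Type*} [NormedAddCommGroup E] [NormedSpace ℝ E]
    [FiniteDimensional ℝ E] [MeasurableSpace E] [BorelSpace E] [Nontrivial E]
    (μ : Measure E) [μ.IsAddHaarMeasure] {f : ℝ → ENNReal} (hf : Measurable f) :
    ∫⁻ w, f ‖w‖ ∂μ = μ.toSphere univ *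
      ∫⁻ r in Ioi (0 : ℝ), ENNReal.ofReal (r ^ (Module.finrank ℝ E - 1)) * f r := by
  calc
    ∫⁻ w, f ‖w‖ ∂μ = ∫⁻ w : ({(0)}ᶜ : Set E), f ‖w.1‖ ∂(μ.comap (↑)) := by
      rw [lintegral_subtype_comap (measurableSet_singleton _).compl fun w ↦ f ‖w‖,
        restrict_compl_singleton]
    _ = ∫⁻ p, f p.2 ∂μ.toSphere.prod (.volumeIoiPow (Module.finrank ℝ E - 1)) := by
      simpa using μ.measurePreserving_homeomorphUnitSphereProd.lintegral_comp_emb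
        (Homeomorph.measurableEmbedding _) (f ∘ Subtype.val ∘ Prod.snd)
    _ = μ.toSphere univ *
        ∫⁻ r : Ioi (0 : ℝ), f r ∂.volumeIoiPow (Module.finrank ℝ E - 1) := by
      rw [lintegral_prod _ (by fun_prop)]
      simp only [lintegral_const, mul_comm]
    _ = _ := by
      rw [Measure.volumeIoiPow, lintegral_withDensity_eq_lintegral_mul _ (by fun_prop)
        (by fun_prop)]
      congr 1
      exact lintegral_subtype_comap measurableSet_Ioi
        (fun r : ℝ ↦ ENNReal.ofReal (r ^ (Module.finrank ℝ E - 1)) * f r)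

open Set Real in
/-- Integration of a function invariant under rotations about the first coordinate axis, in
spherical coordinates. -/
theorem lintegral_axial_eq_toSphere_mul (n : ℕ) {H : ℝ → ℝ → ENNReal}
    (hH : Measurable (Function.uncurry H)) :
    ∫⁻ w : EuclideanSpace ℝ (Fin (n + 2)), H (w 0) ‖w‖ =
      (volume : Measure (EuclideanSpace ℝ (Fin (n + 1)))).toSphere univ *
        ∫⁻ ρ in Ioi (0 : ℝ), ∫⁻ θ in Ioo 0 π,
          ENNReal.ofReal (ρ ^ (n + 1) * sin θ ^ n) * H (ρ * cos θ) ρ := by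
  have hH' : ∀ {α : Type} [MeasurableSpace α] {a b : α → ℝ}, Measurable a → Measurable b →
      Measurable (fun t ↦ H (a t) (b t)) := fun ha hb ↦ hH.comp (ha.prodMk hb)
  have hpi : ∫⁻ w : EuclideanSpace ℝ (Fin (n + 2)), H (w 0) ‖w‖ =
      ∫⁻ v : Fin (n + 2) → ℝ, H (v 0) √(v 0 ^ 2 + ∑ i : Fin (n + 1), v i.succ ^ 2) := by
    rw [← (PiLp.volume_preserving_toLp (Fin (n + 2))).lintegral_comp_emb
      (MeasurableEquiv.toLp 2 _).measurableEmbedding]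
    simp [EuclideanSpace.norm_eq, Fin.sum_univ_succ]
  have hsplit : ∫⁻ v : Fin (n + 2) → ℝ, H (v 0) √(v 0 ^ 2 + ∑ i : Fin (n + 1), v i.succ ^ 2) =
      ∫⁻ s : ℝ, ∫⁻ u : Fin (n + 1) → ℝ, H s √(s ^ 2 + ∑ i, u i ^ 2) := by
    have := (volume_preserving_piFinSuccAbove (fun _ : Fin (n + 2) ↦ ℝ) 0).lintegral_comp_emb
      (MeasurableEquiv.measurableEmbedding _)
      (fun p : ℝ × (Fin (n + 1) → ℝ) ↦ H p.1 √(p.1 ^ 2 + ∑ i, p.2 i ^ 2))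
    rw [Measure.volume_eq_prod, lintegral_prod _ (hH' (by fun_prop) (by fun_prop)).aemeasurable]
      at this
    rw [← this]
    simp [MeasurableEquiv.piFinSuccAbove, Fin.tail]
  have hradial : ∀ s : ℝ, ∫⁻ u : Fin (n + 1) → ℝ, H s √(s ^ 2 + ∑ i, u i ^ 2) =
      (volume : Measure (EuclideanSpace ℝ (Fin (n + 1)))).toSphere univ *
        ∫⁻ r in Ioi (0 : ℝ), ENNReal.ofReal (r ^ n) * H s √(s ^ 2 + r ^ 2) := by
    intro s
    have h := lintegral_norm_eq_toSphere_mul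
      (volume : Measure (EuclideanSpace ℝ (Fin (n + 1)))) (f := fun r ↦ H s √(s ^ 2 + r ^ 2))
      (hH' (by fun_prop) (by fun_prop))
    rw [finrank_euclideanSpace_fin, Nat.add_sub_cancel] at h
    rw [← h, ← (PiLp.volume_preserving_toLp (Fin (n + 1))).lintegral_comp_emb
      (MeasurableEquiv.toLp 2 _).measurableEmbedding]
    simp [EuclideanSpace.norm_sq_eq]
  have hm : Measurable (fun p : ℝ × ℝ ↦
      (Ioi (0 : ℝ)).indicator (fun r ↦ ENNReal.ofReal (r ^ n) * H p.1 √(p.1 ^ 2 + r ^ 2)) p.2) := by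
    have : (fun p : ℝ × ℝ ↦
      (Ioi (0 : ℝ)).indicator (fun r ↦ ENNReal.ofReal (r ^ n) * H p.1 √(p.1 ^ 2 + r ^ 2)) p.2) =
      (Prod.snd ⁻¹' (Ioi (0 : ℝ))).indicator
        (fun p : ℝ × ℝ ↦ ENNReal.ofReal (p.2 ^ n) * H p.1 √(p.1 ^ 2 + p.2 ^ 2)) := rfl
    rw [this]
    refine Measurable.indicator (.mul (by fun_prop) (hH' (by fun_prop) (by fun_prop)))
      (measurable_snd measurableSet_Ioi)
  have hpolar : Measurable (polarCoord.symm : ℝ × ℝ → ℝ × ℝ) :=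
    continuous_polarCoord_symm.measurable
  have hm' : Measurable (fun p : ℝ × ℝ ↦ ENNReal.ofReal p.1 •
      (Ioi (0 : ℝ)).indicator (fun r ↦ ENNReal.ofReal (r ^ n) *
        H (polarCoord.symm p).1 √((polarCoord.symm p).1 ^ 2 + r ^ 2)) (polarCoord.symm p).2) :=
    measurable_fst.ennreal_ofReal.smul (hm.comp hpolar)
  rw [hpi, hsplit]
  simp_rw [hradial]
  rw [lintegral_const_mul' _ _ (measure_ne_top _ _)]
  congr 1
  simp_rw [← lintegral_indicator (measurableSet_Ioi (a := (0 : ℝ)))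
    (fun r ↦ ENNReal.ofReal (r ^ n) * H _ √(_ ^ 2 + r ^ 2))]
  rw [← lintegral_prod _ hm.aemeasurable, ← Measure.volume_eq_prod,
    ← lintegral_comp_polarCoord_symm, polarCoord_target, Measure.volume_eq_prod,
    ← Measure.prod_restrict, lintegral_prod _ hm'.aemeasurable]
  refine setLIntegral_congr_fun measurableSet_Ioi fun ρ hρ ↦ ?_
  have hρ : 0 < ρ := hρ
  rw [← lintegral_indicator measurableSet_Ioo, ← lintegral_indicator measurableSet_Ioo]
  refine lintegral_congr fun θ ↦ ?_
  have hsq : √((ρ * cos θ) ^ 2 + (ρ * sin θ) ^ 2) = ρ := by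
    rw [show (ρ * cos θ) ^ 2 + (ρ * sin θ) ^ 2 = ρ ^ 2 * (sin θ ^ 2 + cos θ ^ 2) by ring,
      sin_sq_add_cos_sq, mul_one, sqrt_sq hρ.le]
  by_cases h : θ ∈ Ioo 0 π
  · have hs := sin_pos_of_mem_Ioo h
    rw [indicator_of_mem h, indicator_of_mem (mem_Ioo.2 ⟨by linarith [h.1, pi_pos], h.2⟩)]
    simp only [polarCoord_symm_apply]
    rw [indicator_of_mem (mem_Ioi.2 (mul_pos hρ hs)), hsq, smul_eq_mul, ← mul_assoc,
      ← ENNReal.ofReal_mul hρ.le]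
    ring_nf
  · rw [indicator_of_notMem h]
    by_cases h' : θ ∈ Ioo (-π) π
    · have hs : sin θ ≤ 0 :=
        sin_nonpos_of_nonpos_of_neg_pi_le (not_lt.1 fun h0 ↦ h ⟨h0, h'.2⟩) h'.1.le
      rw [indicator_of_mem h']
      simp only [polarCoord_symm_apply]
      rw [indicator_of_notMem (notMem_Ioi.2
        (mul_nonpos_of_nonneg_of_nonpos hρ.le hs)), smul_zero]
    · rw [indicator_of_notMem h']

open Set Real in
/-- The average of the Newtonian kernel of `ℝ⁹` over a sphere, as an integral in the polar angle. -/
theorem integral_sin_pow_seven_div_sqrt_pow {x ρ : ℝ} (hx : 0 < x) (hρ : 0 < ρ) (hne : x ≠ ρ) :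
    ∫ θ in (0 : ℝ)..π, sin θ ^ 7 * √(x ^ 2 + ρ ^ 2 - 2 * x * (ρ * cos θ)) ^ (-7 : ℤ) =
      32 / 35 * max x ρ ^ (-7 : ℤ) := by
  have hpos : ∀ θ, 0 < x ^ 2 + ρ ^ 2 - 2 * x * (ρ * cos θ) := by
    intro θ
    have h1 : 0 < (x - ρ) ^ 2 := by have := sub_ne_zero.2 hne; positivity
    nlinarith [mul_nonneg (mul_pos hx hρ).le (sub_nonneg.2 (cos_le_one θ))]
  set D : ℝ → ℝ := fun θ ↦ √(x ^ 2 + ρ ^ 2 - 2 * x * (ρ * cos θ)) with hD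
  have hDpos : ∀ θ, 0 < D θ := fun θ ↦ sqrt_pos.2 (hpos θ)
  have hDsq : ∀ θ, D θ ^ 2 = x ^ 2 + ρ ^ 2 - 2 * x * (ρ * cos θ) := fun θ ↦ sq_sqrt (hpos θ).le
  have hDderiv : ∀ θ, HasDerivAt D (x * ρ * sin θ / D θ) θ := by
    intro θ
    have h := ((((hasDerivAt_cos θ).const_mul ρ).const_mul (2 * x)).const_sub
      (x ^ 2 + ρ ^ 2)).sqrt (hpos θ).ne'
    convert h using 1
    have := (hDpos θ).ne'
    simp only [hD] at this ⊢
    field_simp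
  set s := 2 * (x ^ 2 + ρ ^ 2) with hs
  set p := (x ^ 2 - ρ ^ 2) ^ 2 with hp
  let Q : ℝ → ℝ := fun d ↦ -(d ^ 7 / 7) + 3 * s / 5 * d ^ 5 - (s ^ 2 + p) * d ^ 3
    + (s ^ 3 + 6 * s * p) * d + (3 * s ^ 2 * p + 3 * p ^ 2) * d ^ (-1 : ℤ)
    - s * p ^ 2 * d ^ (-3 : ℤ) + p ^ 3 / 5 * d ^ (-5 : ℤ)
  have hQ : ∀ d, 0 < d → HasDerivAt Q ((-d ^ 2 + s - p / d ^ 2) ^ 3) d := by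
    intro d hd
    have hd' := hd.ne'
    have h := (((((((hasDerivAt_pow 7 d).div_const 7).neg.add
      ((hasDerivAt_pow 5 d).const_mul (3 * s / 5))).sub
      ((hasDerivAt_pow 3 d).const_mul (s ^ 2 + p))).add
      ((hasDerivAt_id d).const_mul (s ^ 3 + 6 * s * p))).add
      ((hasDerivAt_zpow (-1) d (.inl hd')).const_mul (3 * s ^ 2 * p + 3 * p ^ 2))).sub
      ((hasDerivAt_zpow (-3) d (.inl hd')).const_mul (s * p ^ 2))).add
      ((hasDerivAt_zpow (-5) d (.inl hd')).const_mul (p ^ 3 / 5))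
    refine h.congr_deriv ?_
    norm_num
    field_simp
    ring
  have hF : ∀ θ, HasDerivAt (fun θ ↦ Q (D θ) / (64 * (x * ρ) ^ 7))
      (sin θ ^ 7 * D θ ^ (-7 : ℤ)) θ := by
    intro θ
    refine (((hQ _ (hDpos θ)).comp θ (hDderiv θ)).div_const _).congr_deriv ?_
    have hd := (hDpos θ).ne'
    have key : -D θ ^ 2 + s - p / D θ ^ 2 = 4 * (x * ρ) ^ 2 * sin θ ^ 2 / D θ ^ 2 := by
      rw [sin_sq]
      field_simp
      rw [hDsq, hs, hp]
      ring
    rw [key, show D θ ^ (-7 : ℤ) = (D θ ^ 7)⁻¹ from zpow_neg _ 7]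
    field_simp
    ring
  have hcont : Continuous (fun θ ↦ sin θ ^ 7 * D θ ^ (-7 : ℤ)) :=
    (continuous_sin.pow 7).mul ((show Continuous D by fun_prop).zpow₀ _
      fun θ ↦ .inl (hDpos θ).ne')
  rw [intervalIntegral.integral_eq_sub_of_hasDerivAt (fun θ _ ↦ hF θ)
    (hcont.intervalIntegrable _ _)]
  have hDpi : D π = x + ρ := by
    rw [hD]
    simp only [cos_pi]
    rw [show x ^ 2 + ρ ^ 2 - 2 * x * (ρ * -1) = (x + ρ) ^ 2 by ring, sqrt_sq (by positivity)]
  have hD0 : D 0 = |x - ρ| := by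
    rw [hD]
    simp only [cos_zero]
    rw [show x ^ 2 + ρ ^ 2 - 2 * x * (ρ * 1) = (x - ρ) ^ 2 by ring, sqrt_sq_eq_abs]
  have hz : ∀ d : ℝ, d ^ (-1 : ℤ) = d⁻¹ ∧ d ^ (-3 : ℤ) = (d ^ 3)⁻¹ ∧ d ^ (-5 : ℤ) = (d ^ 5)⁻¹ ∧
      d ^ (-7 : ℤ) = (d ^ 7)⁻¹ :=
    fun d ↦ ⟨zpow_neg_one d, zpow_neg d 3, zpow_neg d 5, zpow_neg d 7⟩
  have hQdiff : ∀ A B : ℝ, 0 < A → 0 < B → A ^ 2 + B ^ 2 = s → A ^ 2 * B ^ 2 = p →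
      Q A - Q B = 16 / 35 * (A - B) ^ 7 := by
    intro A B hA hB h1 h2
    simp only [Q, ← h1, ← h2, hz]
    field_simp
    ring
  have hB : 0 < |x - ρ| := abs_pos.2 (sub_ne_zero.2 hne)
  have hAB := hQdiff (x + ρ) |x - ρ| (by positivity) hB (by rw [sq_abs, hs]; ring)
    (by rw [sq_abs, hp]; ring)
  rw [hDpi, hD0, ← sub_div, hAB, (hz _).2.2.2]
  rcases lt_or_gt_of_ne hne with h | h
  · rw [max_eq_right h.le, abs_of_neg (sub_neg.2 h)]
    field_simp
    ring
  · rw [max_eq_left h.le, abs_of_pos (sub_pos.2 h)]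
    field_simp
    ring

open Set Real in
theorem setLIntegral_sin_pow_seven_div_sqrt_pow {x ρ : ℝ} (hx : 0 < x) (hρ : 0 < ρ)
    (hne : x ≠ ρ) :
    ∫⁻ θ in Ioo 0 π,
      ENNReal.ofReal (sin θ ^ 7 * √(x ^ 2 + ρ ^ 2 - 2 * x * (ρ * cos θ)) ^ (-7 : ℤ)) =
      ENNReal.ofReal (32 / 35 * max x ρ ^ (-7 : ℤ)) := by
  have h := integral_sin_pow_seven_div_sqrt_pow hx hρ hne
  have hint : IntegrableOn
      (fun θ ↦ sin θ ^ 7 * √(x ^ 2 + ρ ^ 2 - 2 * x * (ρ * cos θ)) ^ (-7 : ℤ)) (Ioc 0 π) := by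
    by_contra hc
    rw [intervalIntegral.integral_of_le pi_pos.le, integral_undef hc] at h
    have : 0 < 32 / 35 * max x ρ ^ (-7 : ℤ) := by have : 0 < max x ρ := lt_max_of_lt_left hx; positivity
    exact this.ne h
  rw [← h, intervalIntegral.integral_of_le pi_pos.le, setLIntegral_congr Ioo_ae_eq_Ioc,
    ofReal_integral_eq_lintegral_ofReal hint]
  filter_upwards [ae_restrict_mem measurableSet_Ioc] with θ hθ
  have := sin_nonneg_of_mem_Icc ⟨hθ.1.le, hθ.2⟩
  positivity

open Set Real in
theorem toSphere_nine_eq_mul_toSphere_eight :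
    (volume : Measure (EuclideanSpace ℝ (Fin 9))).toSphere univ =
      (volume : Measure (EuclideanSpace ℝ (Fin 8))).toSphere univ * ENNReal.ofReal (32 / 35) := by
  let f : ℝ → ENNReal := (Ioo (0 : ℝ) 1).indicator fun r ↦ (ENNReal.ofReal (r ^ 8))⁻¹
  have hf : Measurable f := Measurable.indicator (by fun_prop) measurableSet_Ioo
  have hfr : ∀ r, ENNReal.ofReal (r ^ 8) * f r = (Ioo (0 : ℝ) 1).indicator 1 r := by
    intro r
    by_cases hr : r ∈ Ioo (0 : ℝ) 1
    · have h0 : 0 < r := hr.1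
      simp only [f, indicator_of_mem hr, Pi.one_apply]
      exact ENNReal.mul_inv_cancel (ENNReal.ofReal_pos.2 (by positivity)).ne' ENNReal.ofReal_ne_top
    · simp only [f, indicator_of_notMem hr, mul_zero]
  have hone : ∫⁻ r in Ioi (0 : ℝ), (Ioo (0 : ℝ) 1).indicator (1 : ℝ → ENNReal) r = 1 := by
    rw [lintegral_indicator measurableSet_Ioo, Measure.restrict_restrict measurableSet_Ioo,
      inter_eq_left.2 Ioo_subset_Ioi_self]
    simp
  have hsin : ∫⁻ θ in Ioo 0 π, ENNReal.ofReal (sin θ ^ 7) = ENNReal.ofReal (32 / 35) := by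
    have h : ∫ θ in (0 : ℝ)..π, sin θ ^ 7 = 32 / 35 := by
      rw [show 7 = 2 * 3 + 1 from rfl, integral_sin_pow_odd]
      norm_num [Finset.prod_range_succ]
    rw [← h, intervalIntegral.integral_of_le pi_pos.le, setLIntegral_congr Ioo_ae_eq_Ioc,
      ofReal_integral_eq_lintegral_ofReal (by fun_prop : Continuous _).integrableOn_Ioc]
    filter_upwards [ae_restrict_mem measurableSet_Ioc] with θ hθ
    have := sin_nonneg_of_mem_Icc ⟨hθ.1.le, hθ.2⟩
    positivity
  have h1 := lintegral_norm_eq_toSphere_mul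
    (volume : Measure (EuclideanSpace ℝ (Fin 9))) hf
  have h2 := lintegral_axial_eq_toSphere_mul 7 (H := fun _ ρ ↦ f ρ) (hf.comp measurable_snd)
  have h3 : ∀ ρ ∈ Ioi (0 : ℝ), ∫⁻ θ in Ioo 0 π, ENNReal.ofReal (ρ ^ (7 + 1) * sin θ ^ 7) * f ρ =
      ENNReal.ofReal (32 / 35) * (Ioo (0 : ℝ) 1).indicator 1 ρ := by
    intro ρ hρ
    have hρ : 0 < ρ := hρ
    rw [← hfr, ← hsin, ← lintegral_mul_const _ (by fun_prop)]
    refine lintegral_congr fun θ ↦ ?_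
    rw [ENNReal.ofReal_mul (by positivity)]
    ring
  rw [setLIntegral_congr_fun measurableSet_Ioi h3,
    lintegral_const_mul _ (measurable_one.indicator measurableSet_Ioo), hone, mul_one] at h2
  simp only [finrank_euclideanSpace_fin, Nat.add_one_sub_one, hfr, hone, mul_one] at h1
  exact h1.symm.trans h2

open Set Real in
/-- Newton's shell theorem in `ℝ⁹`, integrated against a radial weight. -/
theorem lintegral_radial_mul_norm_sub_zpow (z : EuclideanSpace ℝ (Fin 9)) (hz : z ≠ 0)
    {f : ℝ → ENNReal} (hf : Measurable f) :
    ∫⁻ w, f ‖w‖ * ENNReal.ofReal (‖w - z‖ ^ (-7 : ℤ)) =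
      (volume : Measure (EuclideanSpace ℝ (Fin 9))).toSphere univ *
        ∫⁻ ρ in Ioi (0 : ℝ), f ρ * ENNReal.ofReal (ρ ^ 8 * max ‖z‖ ρ ^ (-7 : ℤ)) := by
  have hx : 0 < ‖z‖ := norm_pos_iff.2 hz
  set x := ‖z‖ with hxdef
  let e : EuclideanSpace ℝ (Fin 9) := EuclideanSpace.single 0 x
  let R := (Submodule.span ℝ {z - e})ᗮ.reflection
  have hR : R z = e := Submodule.reflection_sub (by simp [e, hxdef])
  let H : ℝ → ℝ → ENNReal := fun s ρ ↦
    f ρ * ENNReal.ofReal (√(x ^ 2 + ρ ^ 2 - 2 * x * s) ^ (-7 : ℤ))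
  have hH : Measurable (Function.uncurry H) := by
    refine (hf.comp measurable_snd).mul (Measurable.ennreal_ofReal (Measurable.pow_const ?_ _))
    fun_prop
  have hnorm : ∀ w : EuclideanSpace ℝ (Fin 9), ‖w - e‖ = √(x ^ 2 + ‖w‖ ^ 2 - 2 * x * w 0) := by
    intro w
    rw [← sqrt_sq (norm_nonneg (w - e)), norm_sub_sq_real]
    congr 1
    simp [e, EuclideanSpace.inner_single_right]
    ring
  have hrot : ∫⁻ w, f ‖w‖ * ENNReal.ofReal (‖w - z‖ ^ (-7 : ℤ)) =
      ∫⁻ w : EuclideanSpace ℝ (Fin 9), H (w 0) ‖w‖ := by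
    rw [← R.measurePreserving.lintegral_comp_emb R.toMeasurableEquiv.measurableEmbedding
      (fun w : EuclideanSpace ℝ (Fin 9) ↦ H (w 0) ‖w‖)]
    refine lintegral_congr fun w ↦ ?_
    simp only [H]
    rw [← hnorm, ← hR, ← map_sub, R.norm_map, R.norm_map]
  rw [hrot, lintegral_axial_eq_toSphere_mul 7 hH, toSphere_nine_eq_mul_toSphere_eight, mul_assoc,
    ← lintegral_const_mul' _ _ ENNReal.ofReal_ne_top]
  congr 1
  have hae : ∀ᵐ ρ ∂(volume : Measure ℝ), ρ ≠ x := Measure.ae_ne volume x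
  refine setLIntegral_congr_fun_ae measurableSet_Ioi (hae.mono fun ρ hne hρ ↦ ?_)
  have hρ : 0 < ρ := hρ
  calc
    _ = ∫⁻ θ in Ioo 0 π, (f ρ * ENNReal.ofReal (ρ ^ 8)) *
        ENNReal.ofReal (sin θ ^ 7 * √(x ^ 2 + ρ ^ 2 - 2 * x * (ρ * cos θ)) ^ (-7 : ℤ)) := by
      refine lintegral_congr fun θ ↦ ?_
      simp only [H]
      rw [ENNReal.ofReal_mul (by positivity), ENNReal.ofReal_mul' (by positivity)]
      ring
    _ = _ := by
      have hm : Measurable (fun θ ↦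
          sin θ ^ 7 * √(x ^ 2 + ρ ^ 2 - 2 * x * (ρ * cos θ)) ^ (-7 : ℤ)) :=
        Measurable.mul (by fun_prop) (Measurable.pow_const (by fun_prop) _)
      rw [lintegral_const_mul _ hm.ennreal_ofReal,
        setLIntegral_sin_pow_seven_div_sqrt_pow hx hρ hne.symm,
        ENNReal.ofReal_mul (by positivity), ENNReal.ofReal_mul (by positivity)]
      ring

open Set in
/-- Newton's shell theorem for the weight `‖w‖⁻⁴` on a ball. -/
theorem setIntegral_closedBall_norm_zpow_mul_norm_sub_zpow (z : EuclideanSpace ℝ (Fin 9))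
    (hz : z ≠ 0) (ε : ℝ) (hε : 0 < ε) :
    ∫ w in Metric.closedBall (0 : EuclideanSpace ℝ (Fin 9)) ε,
        ‖w‖ ^ (-4 : ℤ) * ‖w - z‖ ^ (-7 : ℤ) ∂volume
      = ((volume : Measure (EuclideanSpace ℝ (Fin 9))).toSphere univ).toReal *
          ∫ ρ in (0:ℝ)..ε, ρ ^ 4 * max ‖z‖ ρ ^ (-7 : ℤ) := by
  have hzpow : ∀ n : ℤ, Measurable fun r : ℝ ↦ r ^ n := fun n ↦ measurable_id.pow_const n
  let f : ℝ → ENNReal := (Iic ε).indicator fun r ↦ ENNReal.ofReal (r ^ (-4 : ℤ))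
  have hf : Measurable f := (hzpow _).ennreal_ofReal.indicator measurableSet_Iic
  have h := lintegral_radial_mul_norm_sub_zpow z hz hf
  have hl : ∫⁻ w, f ‖w‖ * ENNReal.ofReal (‖w - z‖ ^ (-7 : ℤ)) =
      ∫⁻ w in Metric.closedBall (0 : EuclideanSpace ℝ (Fin 9)) ε,
        ENNReal.ofReal (‖w‖ ^ (-4 : ℤ) * ‖w - z‖ ^ (-7 : ℤ)) := by
    rw [← lintegral_indicator Metric.isClosed_closedBall.measurableSet]
    refine lintegral_congr fun w ↦ ?_
    by_cases hw : ‖w‖ ≤ ε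
    · rw [indicator_of_mem (by simpa using hw), ENNReal.ofReal_mul (by positivity)]
      simp only [f, indicator_of_mem (mem_Iic.2 hw)]
    · rw [indicator_of_notMem (by simpa using hw)]
      simp only [f, indicator_of_notMem (mem_Iic.not.2 hw), zero_mul]
  have hr : ∫⁻ ρ in Ioi (0 : ℝ), f ρ * ENNReal.ofReal (ρ ^ 8 * max ‖z‖ ρ ^ (-7 : ℤ)) =
      ∫⁻ ρ in Ioc 0 ε, ENNReal.ofReal (ρ ^ 4 * max ‖z‖ ρ ^ (-7 : ℤ)) := by
    rw [← lintegral_indicator measurableSet_Ioi, ← lintegral_indicator measurableSet_Ioc]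
    refine lintegral_congr fun ρ ↦ ?_
    by_cases h0 : 0 < ρ
    · rw [indicator_of_mem (mem_Ioi.2 h0)]
      by_cases hρ : ρ ≤ ε
      · rw [indicator_of_mem (mem_Ioc.2 ⟨h0, hρ⟩)]
        simp only [f, indicator_of_mem (mem_Iic.2 hρ)]
        rw [← ENNReal.ofReal_mul (by positivity), ← mul_assoc]
        congr 2
        rw [show ρ ^ (-4 : ℤ) = (ρ ^ 4)⁻¹ from zpow_neg ρ 4]
        field_simp
      · rw [indicator_of_notMem fun hc ↦ hρ hc.2]
        simp only [f, indicator_of_notMem (mem_Iic.not.2 hρ), zero_mul]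
    · rw [indicator_of_notMem (mem_Ioi.not.2 h0), indicator_of_notMem fun hc ↦ h0 hc.1]
  have hml : Measurable fun w : EuclideanSpace ℝ (Fin 9) ↦
      ‖w‖ ^ (-4 : ℤ) * ‖w - z‖ ^ (-7 : ℤ) :=
    ((hzpow _).comp measurable_norm).mul ((hzpow _).comp (measurable_id.sub_const z).norm)
  have hmr : Measurable fun ρ : ℝ ↦ ρ ^ 4 * max ‖z‖ ρ ^ (-7 : ℤ) :=
    (measurable_id.pow_const 4).mul ((hzpow _).comp (measurable_const.max measurable_id))
  rw [integral_eq_lintegral_of_nonneg_ae (.of_forall fun w ↦ by positivity)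
    hml.aestronglyMeasurable,
    intervalIntegral.integral_of_le hε.le,
    integral_eq_lintegral_of_nonneg_ae
      ((ae_restrict_mem measurableSet_Ioc).mono fun ρ hρ ↦ by positivity)
      hmr.aestronglyMeasurable,
    ← ENNReal.toReal_mul, ← hl, h, hr]

/-- `∫_{‖w‖ ≤ ε} ‖w‖⁻⁴ ‖w − z‖⁻⁷ λ(dw) = Σ(S⁸) ∫_0^ε ρ⁴ (x ∨ ρ)⁻⁷ dρ` with `x = ‖z‖`. -/
theorem stmt9 (z : EuclideanSpace ℝ (Fin 9)) (hz : z ≠ 0) (ε : ℝ) (hε : 0 < ε) :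
    ∫ w in Metric.closedBall (0 : EuclideanSpace ℝ (Fin 9)) ε,
        ‖w‖ ^ (-4 : ℤ) * ‖w - z‖ ^ (-7 : ℤ) ∂volume
      = (sphereMeasure Set.univ).toReal *
          ∫ ρ in (0:ℝ)..ε, ρ ^ 4 * max ‖z‖ ρ ^ (-7 : ℤ) := by
  exact setIntegral_closedBall_norm_zpow_mul_norm_sub_zpow z hz ε hε
end

section
/- Let M be a metric space equipped with its Borel σ-field, let p : [0,1] → M be continuous, let ν be the pushforward of Lebesgue measure on [0,1] under p, let g : M → [0,∞) be a bounded Borel function, and let μ := g·ν be the measure with density g with respect to ν. Assume that for every s ∈ (0,1), ν( p([0,s]) ∩ p((s,1]) ) = 0. Then for every s ∈ [0,1], μ( p([0,s]) ) = ∫_0^s g(p(r)) dr. -/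
open MeasureTheory

/-- Let `p : [0,1] → M` be continuous, `ν` the pushforward of Lebesgue measure on `[0,1]`
under `p`, `g : M → [0,∞)` bounded Borel and `μ = g·ν`.  If
`ν(p([0,s]) ∩ p((s,1])) = 0` for every `s ∈ (0,1)`, then
`μ(p([0,s])) = ∫_0^s g(p(r)) dr` for every `s ∈ [0,1]`. -/
theorem stmt17 (M : Type) [MetricSpace M] [MeasurableSpace M] [BorelSpace M]
    (p : Set.Icc (0:ℝ) 1 → M) (hp : Continuous p)
    (ν : Measure M)
    (hν : ν = Measure.map p (Measure.comap Subtype.val (volume : Measure ℝ)))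
    (g : M → ℝ) (hg : Measurable g) (hg0 : ∀ a, 0 ≤ g a) (hgbd : ∃ Cg : ℝ, ∀ a, g a ≤ Cg)
    (μ : Measure M) (hμ : μ = ν.withDensity fun a => ENNReal.ofReal (g a))
    (hdisj : ∀ s : ℝ, s ∈ Set.Ioo (0:ℝ) 1 →
      ν (p '' {r : Set.Icc (0:ℝ) 1 | (r : ℝ) ≤ s} ∩
          p '' {r : Set.Icc (0:ℝ) 1 | s < (r : ℝ)}) = 0) :
    ∀ s : ℝ, s ∈ Set.Icc (0:ℝ) 1 →
      μ (p '' {r : Set.Icc (0:ℝ) 1 | (r : ℝ) ≤ s})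
        = ∫⁻ r in {r : Set.Icc (0:ℝ) 1 | (r : ℝ) ≤ s}, ENNReal.ofReal (g (p r))
            ∂(Measure.comap Subtype.val (volume : Measure ℝ)) := by
  intro s hs
  set lam : Measure (Set.Icc (0:ℝ) 1) := Measure.comap Subtype.val (volume : Measure ℝ) with hlam
  have hpm : Measurable p := hp.measurable
  have hclosed : IsClosed {r : Set.Icc (0:ℝ) 1 | (r : ℝ) ≤ s} :=
    isClosed_le continuous_subtype_val continuous_const
  have hmeas : MeasurableSet (p '' {r : Set.Icc (0:ℝ) 1 | (r : ℝ) ≤ s}) :=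
    (hclosed.isCompact.image hp).measurableSet
  have hnull : lam (p ⁻¹' (p '' {r : Set.Icc (0:ℝ) 1 | (r : ℝ) ≤ s}) \
      {r : Set.Icc (0:ℝ) 1 | (r : ℝ) ≤ s}) = 0 := by
    rcases hs.1.eq_or_lt with rfl | h0
    · have hzero : ∀ r : Set.Icc (0:ℝ) 1, (r : ℝ) ≤ 0 → r = 0 :=
        fun r hr => Subtype.ext (le_antisymm hr r.2.1)
      by_cases h : ∃ r : Set.Icc (0:ℝ) 1, 0 < (r : ℝ) ∧ p r = p 0
      · obtain ⟨r, hr, hpr⟩ := h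
        have hν0 := hdisj (r / 2) ⟨by linarith, by linarith [r.2.2]⟩
        rw [hν] at hν0
        refine measure_mono_null ?_ (Measure.preimage_null_of_map_null hpm.aemeasurable hν0)
        rintro x ⟨⟨y, hy, hyx⟩, -⟩
        rw [hzero y hy] at hyx
        refine ⟨⟨0, ?_, hyx⟩, ⟨r, ?_, hpr.trans hyx⟩⟩
        · change (0:ℝ) ≤ r / 2
          linarith
        · change (r:ℝ) / 2 < r
          linarith
      · convert measure_empty (μ := lam)
        refine Set.eq_empty_of_forall_notMem ?_
        rintro x ⟨⟨y, hy, hyx⟩, hx⟩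
        rw [hzero y hy] at hyx
        exact h ⟨x, not_le.mp hx, hyx.symm⟩
    · rcases hs.2.eq_or_lt with rfl | h1
      · convert measure_empty (μ := lam)
        exact Set.eq_empty_of_forall_notMem fun x hx => hx.2 x.2.2
      · have hνs := hdisj s ⟨h0, h1⟩
        rw [hν] at hνs
        refine measure_mono_null ?_ (Measure.preimage_null_of_map_null hpm.aemeasurable hνs)
        rintro x ⟨hx, hxs⟩
        exact ⟨hx, Set.mem_image_of_mem p (show s < (x : ℝ) from not_le.mp hxs)⟩
  rw [hμ, withDensity_apply _ hmeas, hν, setLIntegral_map hmeas hg.ennreal_ofReal hpm]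
  refine setLIntegral_congr (Filter.EventuallyLE.antisymm (ae_le_set.mpr hnull) ?_)
  exact (Set.subset_preimage_image p _).eventuallyLE
end
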